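/- For any two L-classes C1 and C2 of binary trees, the element (Σ_{t1∈C1} c_{t1}) ▷ (Σ_{t2∈C2} c_{t2}) is a linear combination of the elements Σ_{t∈C} c_t, where C ranges over L-classes; that is, the linear span of the L-class sums is closed under the preLie product ▷. -/

import Mathlib

/-- The free module on words of positive integers, with coefficients in `R`.
`ℚ[S_n]` is identified with the span of the permutation words of {1,…,n}. -/
abbrev FW (R : Type) [CommRing R] := (List ℕ) →₀ R

variable {R : Type} [CommRing R]

/-- Concatenation product, extended bilinearly. -/
noncomputable def catW (x y : FW R) : FW R :=
  x.sum fun u a => y.sum fun v b => Finsupp.single (u ++ v) (a * b)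

/-- The bracket [x,y] = x·y − y·x of the concatenation product. -/
noncomputable def brakW (x y : FW R) : FW R := catW x y - catW y x

/-- (Incomplete) binary trees; `nil` is the empty tree. The complete binary tree with
`t.nodes + 1` leaves whose internal nodes form `t` is implicit in the definitions below. -/
inductive BT
  | nil : BT
  | nd : BT → BT → BT
deriving DecidableEq

/-- Number of nodes of a binary tree. -/
def BT.nodes : BT → ℕ
  | .nil => 0
  | .nd l r => l.nodes + r.nodes + 1

/-- The evaluation T(σ) of the complete binary tree `T` whose internal nodes form `t`, with
leaves labelled left to right by the word `w`: each leaf gets the one-letter word of its label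
and each internal node the bracket of concatenation. -/
noncomputable def evalBT : BT → List ℕ → FW R
  | .nil, w => Finsupp.single w 1
  | .nd l r, w => brakW (evalBT l (w.take (l.nodes + 1))) (evalBT r (w.drop (l.nodes + 1)))

/-- The standardization of a word with distinct letters: each letter is replaced by its rank. -/
def stdW (w : List ℕ) : List ℕ := w.map fun x => (w.filter (· ≤ x)).length

/-- The set of permutation words of {1, …, n}. -/
def permWords (n : ℕ) : Finset (List ℕ) := (List.range' 1 n).permutations.toFinset

/-- Convolution α⋆β of two permutation words: the sum of all permutation words γ of size
|α|+|β| with std(γ(1)⋯γ(m)) = α and std(γ(m+1)⋯γ(m+n)) = β. -/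
noncomputable def convW (u v : List ℕ) : FW R :=
  ∑ γ ∈ (permWords (u.length + v.length)).filter
      (fun γ => stdW (γ.take u.length) = u ∧ stdW (γ.drop u.length) = v),
    Finsupp.single γ 1

/-- The convolution product, extended bilinearly. -/
noncomputable def starW (x y : FW R) : FW R :=
  x.sum fun u a => y.sum fun v b => (a * b) • convW u v

/-- Whether the word `w` is an admissible labelling of (the completion of) `t`: at each internal
node, the smallest label lies in the left subtree and the largest in the right subtree. -/
def admB : BT → List ℕ → Bool
  | .nil, _ => true
  | .nd l r, w =>
    admB l (w.take (l.nodes + 1)) && admB r (w.drop (l.nodes + 1))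
      && decide ((w.take (l.nodes + 1)).minimum = w.minimum)
      && decide ((w.drop (l.nodes + 1)).maximum = w.maximum)

/-- c_t: the sum of the evaluations T(σ) over all admissible labellings σ of the complete
binary tree whose internal nodes form `t`. -/
noncomputable def cElt (t : BT) : FW R :=
  ∑ w ∈ (permWords (t.nodes + 1)).filter (fun w => admB t w = true), evalBT t w


/-- Word-level half product α≻β: the sum of all permutation words γ of size m+n = |α|+|β| with
std(γ(1)⋯γ(m)) = α, std(γ(m+1)⋯γ(m+n)) = β and the letter m+n among the last n letters. -/
noncomputable def succW (u v : List ℕ) : FW R :=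
  ∑ γ ∈ (permWords (u.length + v.length)).filter
      (fun γ => stdW (γ.take u.length) = u ∧ stdW (γ.drop u.length) = v
        ∧ (u.length + v.length) ∈ γ.drop u.length),
    Finsupp.single γ 1

/-- Word-level half product α≺β: the sum of all permutation words γ of size m+n = |α|+|β| with
std(γ(1)⋯γ(m)) = α, std(γ(m+1)⋯γ(m+n)) = β and the letter m+n among the first m letters. -/
noncomputable def precW (u v : List ℕ) : FW R :=
  ∑ γ ∈ (permWords (u.length + v.length)).filter
      (fun γ => stdW (γ.take u.length) = u ∧ stdW (γ.drop u.length) = v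
        ∧ (u.length + v.length) ∈ γ.take u.length),
    Finsupp.single γ 1

/-- α≻β extended bilinearly. -/
noncomputable def succExt (x y : FW R) : FW R :=
  x.sum fun u a => y.sum fun v b => (a * b) • succW u v

/-- α≺β extended bilinearly. -/
noncomputable def precExt (x y : FW R) : FW R :=
  x.sum fun u a => y.sum fun v b => (a * b) • precW u v

/-- The preLie product x▷y = x≻y − y≺x. -/
noncomputable def preLieW (x y : FW R) : FW R := succExt x y - precExt y x

/-- The finite set of all binary trees with m nodes. -/
def allBT : ℕ → Finset BT
  | 0 => {BT.nil}
  | m + 1 =>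
    (Finset.range (m + 1)).attach.biUnion fun k =>
      ((allBT k.1) ×ˢ (allBT (m - k.1))).image fun p => BT.nd p.1 p.2
decreasing_by
  · exact k.2 |> Finset.mem_range.mp
  · omega

mutual
/-- `LIn t t'`: `t'` is obtained from `t` by an L-move at a vertex `v` of `t` that is the root
of `t` or a right child of its parent: `v` has a right child `w`, and the left subtree of `v`
is exchanged with the left subtree of `w`. (The root of the ambient subtree qualifies.) -/
inductive LIn : BT → BT → Prop
  | here (t1 t2 t3 : BT) : LIn (BT.nd t1 (BT.nd t2 t3)) (BT.nd t2 (BT.nd t1 t3))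
  | congL {l l' : BT} (r : BT) : LSub l l' → LIn (BT.nd l r) (BT.nd l' r)
  | congR (l : BT) {r r' : BT} : LIn r r' → LIn (BT.nd l r) (BT.nd l r')

/-- `LSub t t'`: `t'` is obtained from `t` by an L-move at a vertex that is a right child of
its parent (the root of the ambient subtree itself does not qualify). -/
inductive LSub : BT → BT → Prop
  | congL {l l' : BT} (r : BT) : LSub l l' → LSub (BT.nd l r) (BT.nd l' r)
  | congR (l : BT) {r r' : BT} : LIn r r' → LSub (BT.nd l r) (BT.nd l r')
end

/-- L-equivalence: the equivalence relation on binary trees generated by L-moves. -/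
def LEquiv : BT → BT → Prop := Relation.EqvGen LIn

open scoped Classical in
/-- The sum Σ_{s ∈ C} c_s over the L-class C of the tree t. -/
noncomputable def LclassSum (t : BT) : FW ℚ :=
  ∑ s ∈ (allBT t.nodes).filter (fun s => LEquiv t s), cElt s

namespace LClass

/-! ### Trees -/

theorem mem_allBT {n : ℕ} {t : BT} : t ∈ allBT n ↔ t.nodes = n := by
  induction t generalizing n with
  | nil => cases n <;> simp [allBT, BT.nodes]
  | nd l r ihl ihr =>
    cases n with
    | zero => simp [allBT, BT.nodes]
    | succ n =>
      simp only [allBT, BT.nodes, Finset.mem_biUnion, Finset.mem_attach, true_and,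
        Finset.mem_image, Finset.mem_product, Prod.exists, BT.nd.injEq, Subtype.exists,
        Finset.mem_range]
      constructor
      · rintro ⟨k, hk, a, b, ⟨ha, hb⟩, rfl, rfl⟩
        rw [ihl] at ha
        rw [ihr] at hb
        omega
      · intro h
        exact ⟨l.nodes, by omega, l, r, ⟨ihl.2 rfl, ihr.2 (by omega)⟩, rfl, rfl⟩

theorem LSub.lIn {t t' : BT} (h : LSub t t') : LIn t t' := by
  cases h with
  | congL r h => exact .congL r h
  | congR l h => exact .congR l h

mutual
theorem LIn.nodes_eq {t t' : BT} (h : LIn t t') : t.nodes = t'.nodes := by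
  cases h with
  | here a b c => simp only [BT.nodes]; omega
  | congL r h => simp only [BT.nodes, LSub.nodes_eq h]
  | congR l h => simp only [BT.nodes, LIn.nodes_eq h]

theorem LSub.nodes_eq {t t' : BT} (h : LSub t t') : t.nodes = t'.nodes := by
  cases h with
  | congL r h => simp only [BT.nodes, LSub.nodes_eq h]
  | congR l h => simp only [BT.nodes, LIn.nodes_eq h]
end

theorem LEquiv.nodes_eq {t t' : BT} (h : LEquiv t t') : t.nodes = t'.nodes := by
  induction h with
  | rel _ _ h => exact LIn.nodes_eq h
  | refl => rfl
  | symm _ _ _ ih => exact ih.symm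
  | trans _ _ _ _ _ ih ih' => exact ih.trans ih'

/-- L-equivalence as a setoid. -/
def lSetoid : Setoid BT := Relation.EqvGen.setoid LIn

mutual
/-- The signed sum of `φ (x, t \ v)` over the vertices `v` of `t`, where deleting `v` either
cuts off the left subtree `x` of `v` (if `v` is the root or a right child) or, with sign `-1`,
its right subtree `x` (if `v` is a left child). -/
def cutIn (φ : BT → BT → ℚ) : BT → ℚ
  | .nil => 0
  | .nd l r => φ l r + cutSub (fun x u => φ x (.nd u r)) l + cutIn (fun x u => φ x (.nd l u)) r

/-- The variant of `cutIn` in which the root counts as a left child. -/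
def cutSub (φ : BT → BT → ℚ) : BT → ℚ
  | .nil => 0
  | .nd l r => -φ r l + cutSub (fun x u => φ x (.nd u r)) l + cutIn (fun x u => φ x (.nd l u)) r
end

mutual
theorem cutIn_eq_of_lIn {t t' : BT} (h : LIn t t') (φ : BT → BT → ℚ)
    (hx : ∀ x x' s, LIn x x' → φ x s = φ x' s) (hs : ∀ x s s', LIn s s' → φ x s = φ x s') :
    cutIn φ t = cutIn φ t' := by
  cases h with
  | here a b c =>
    have h₁ : (fun x u => φ x (.nd u (.nd b c))) = fun x u => φ x (.nd b (.nd u c)) := by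
      funext x u
      exact hs _ _ _ (.here _ _ _)
    have h₂ : (fun x u => φ x (.nd a (.nd u c))) = fun x u => φ x (.nd u (.nd a c)) := by
      funext x u
      exact hs _ _ _ (.here _ _ _)
    have h₃ : (fun x u => φ x (.nd a (.nd b u))) = fun x u => φ x (.nd b (.nd a u)) := by
      funext x u
      exact hs _ _ _ (.here _ _ _)
    simp only [cutIn]
    rw [h₁, h₂, h₃]
    ring
  | @congL l l' r h =>
    have h₁ : (fun x u => φ x (.nd l u)) = fun x u => φ x (.nd l' u) := by
      funext x u
      exact hs _ _ _ (.congL _ h)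
    simp only [cutIn]
    rw [h₁, hx l l' r (LSub.lIn h), cutSub_eq_of_lSub h (fun x u => φ x (.nd u r))
        (fun x x' s k => hx _ _ _ k)
      (fun x s s' k => hs _ _ _ (.congL _ k))]
  | @congR l r r' h =>
    have h₁ : (fun x u => φ x (.nd u r)) = fun x u => φ x (.nd u r') := by
      funext x u
      exact hs _ _ _ (.congR _ h)
    simp only [cutIn]
    rw [h₁, hs l r r' h, cutIn_eq_of_lIn h (fun x u => φ x (.nd l u)) (fun x x' s k => hx _ _ _ k)
      (fun x s s' k => hs _ _ _ (.congR _ k))]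

theorem cutSub_eq_of_lSub {t t' : BT} (h : LSub t t') (φ : BT → BT → ℚ)
    (hx : ∀ x x' s, LIn x x' → φ x s = φ x' s) (hs : ∀ x s s', LSub s s' → φ x s = φ x s') :
    cutSub φ t = cutSub φ t' := by
  cases h with
  | @congL l l' r h =>
    have h₁ : (fun x u => φ x (.nd l u)) = fun x u => φ x (.nd l' u) := by
      funext x u
      exact hs _ _ _ (.congL _ h)
    simp only [cutSub]
    rw [h₁, hs r l l' h, cutSub_eq_of_lSub h (fun x u => φ x (.nd u r))
        (fun x x' s k => hx _ _ _ k)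
      (fun x s s' k => hs _ _ _ (.congL _ k))]
  | @congR l r r' h =>
    have h₁ : (fun x u => φ x (.nd u r)) = fun x u => φ x (.nd u r') := by
      funext x u
      exact hs _ _ _ (.congR _ h)
    simp only [cutSub]
    rw [h₁, hx r r' l h, cutIn_eq_of_lIn h (fun x u => φ x (.nd l u)) (fun x x' s k => hx _ _ _ k)
      (fun x s s' k => hs _ _ _ (.congR _ k))]
end

mutual
theorem cutIn_sum {ι : Type*} (S : Finset ι) (φ : ι → BT → BT → ℚ) (t : BT) :
    cutIn (fun x s => ∑ i ∈ S, φ i x s) t = ∑ i ∈ S, cutIn (φ i) t := by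
  cases t with
  | nil => simp [cutIn]
  | nd l r => simp only [cutIn, cutIn_sum S _ r, cutSub_sum S _ l, Finset.sum_add_distrib]

theorem cutSub_sum {ι : Type*} (S : Finset ι) (φ : ι → BT → BT → ℚ) (t : BT) :
    cutSub (fun x s => ∑ i ∈ S, φ i x s) t = ∑ i ∈ S, cutSub (φ i) t := by
  cases t with
  | nil => simp [cutSub]
  | nd l r =>
    simp only [cutSub, cutIn_sum S _ r, cutSub_sum S _ l, Finset.sum_add_distrib,
      Finset.sum_neg_distrib]
end

theorem cutIn_zero (t : BT) : cutIn (fun _ _ => 0) t = 0 := by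
  simpa using cutIn_sum (∅ : Finset ℕ) (fun _ _ _ => 0) t

theorem cutSub_zero (t : BT) : cutSub (fun _ _ => 0) t = 0 := by
  simpa using cutSub_sum (∅ : Finset ℕ) (fun _ _ _ => 0) t

/-- The signed sum of `c u` over the trees `u` obtained from the second tree by inserting, next
to one of its nodes, a new node carrying the tree `x`: above the right child with `x` as left
subtree, or, with sign `-1`, above the left child with `x` as right subtree. -/
def graft {M : Type*} [AddCommGroup M] (c : BT → M) (x : BT) : BT → M
  | .nil => 0
  | .nd l r => c (.nd l (.nd x r)) + graft (fun u => c (.nd l u)) x r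
      + (graft (fun u => c (.nd u r)) x l - c (.nd (.nd l x) r))

section Graft

variable {M N : Type*} [AddCommGroup M] [AddCommGroup N]

theorem graft_congr {c c' : BT → M} {x s : BT}
    (h : ∀ u : BT, u.nodes = x.nodes + s.nodes + 1 → c u = c' u) :
    graft c x s = graft c' x s := by
  induction s generalizing c c' with
  | nil => rfl
  | nd l r ihl ihr =>
    simp only [graft]
    rw [h _ (by simp only [BT.nodes]; omega), h (.nd (.nd l x) r) (by simp only [BT.nodes]; omega),
      ihl fun u hu => h (.nd u r) (by simp only [BT.nodes]; omega),
      ihr fun u hu => h (.nd l u) (by simp only [BT.nodes]; omega)]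

theorem map_graft (f : M →+ N) (c : BT → M) (x s : BT) :
    f (graft c x s) = graft (fun u => f (c u)) x s := by
  induction s generalizing c with
  | nil => simp [graft]
  | nd l r ihl ihr => simp only [graft, map_add, map_sub, ihl, ihr]

theorem graft_sum {ι : Type*} (S : Finset ι) (c : ι → BT → M) (x s : BT) :
    graft (fun u => ∑ i ∈ S, c i u) x s = ∑ i ∈ S, graft (c i) x s := by
  induction s generalizing c with
  | nil => simp [graft]
  | nd l r ihl ihr =>
    simp only [graft, ihl, ihr, Finset.sum_add_distrib, Finset.sum_sub_distrib]

end Graft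

theorem graft_zero (x s : BT) : graft (fun _ => (0 : ℚ)) x s = 0 := by
  simpa using graft_sum (∅ : Finset ℕ) (fun _ _ => (0 : ℚ)) x s

/-- Inserting and cutting are dual to each other. -/
theorem graft_indicator (x s t : BT) :
    ((if BT.nd x s = t then 1 else 0) + graft (fun u => if u = t then (1 : ℚ) else 0) x s
        = cutIn (fun y u => if y = x ∧ u = s then 1 else 0) t) ∧
      (graft (fun u => if u = t then (1 : ℚ) else 0) x s - (if BT.nd s x = t then 1 else 0)
        = cutSub (fun y u => if y = x ∧ u = s then 1 else 0) t) := by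
  induction s generalizing t with
  | nil =>
    cases t with
    | nil => simp [graft, cutIn, cutSub]
    | nd a b =>
      simp [graft, cutIn, cutSub, cutIn_zero, cutSub_zero, eq_comm, and_comm]
  | nd l r ihl ihr =>
    cases t with
    | nil => simp [graft, cutIn, cutSub, graft_zero]
    | nd a b =>
      have hr : (if l = a then (1 : ℚ) else 0) * ((if BT.nd x r = b then 1 else 0)
            + graft (fun u => if u = b then (1 : ℚ) else 0) x r)
          = cutIn (fun y u => if y = x ∧ a = l ∧ u = r then 1 else 0) b := by
        by_cases h : l = a
        · subst h
          simp [(ihr b).1]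
        · simp [h, Ne.symm h, cutIn_zero]
      have hl : (if r = b then (1 : ℚ) else 0)
            * (graft (fun u => if u = a then (1 : ℚ) else 0) x l
              - (if BT.nd l x = a then 1 else 0))
          = cutSub (fun y u => if y = x ∧ u = l ∧ b = r then 1 else 0) a := by
        by_cases h : r = b
        · subst h
          simp [(ihl a).2]
        · simp [h, Ne.symm h, cutSub_zero]
      have key : graft (fun u => if u = .nd a b then (1 : ℚ) else 0) x (.nd l r)
          = cutSub (fun y u => if y = x ∧ u = l ∧ b = r then 1 else 0) a
            + cutIn (fun y u => if y = x ∧ a = l ∧ u = r then 1 else 0) b := by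
        have h₁ : (fun u => if BT.nd l u = .nd a b then (1 : ℚ) else 0) = fun u =>
            AddMonoidHom.mulLeft (if l = a then (1 : ℚ) else 0) (if u = b then 1 else 0) := by
          funext u
          by_cases h : l = a <;> simp [h]
        have h₂ : (fun u => if BT.nd u r = .nd a b then (1 : ℚ) else 0) = fun u =>
            AddMonoidHom.mulLeft (if r = b then (1 : ℚ) else 0) (if u = a then 1 else 0) := by
          funext u
          by_cases h : r = b <;> simp [h]
        simp only [graft]
        rw [← hr, ← hl, h₁, h₂, ← map_graft, ← map_graft]
        by_cases h : l = a <;> by_cases h' : r = b <;> simp [h, h']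
        ring
      simp only [cutIn, cutSub, BT.nd.injEq]
      rw [key]
      constructor
      · simp only [eq_comm, add_assoc]
      · simp only [eq_comm (a := b), eq_comm (a := a), and_comm (a := x = b)]
        ring

/-! ### The concatenation bracket -/

/-- `catW` as a bilinear map. -/
noncomputable def catL : FW ℚ →ₗ[ℚ] FW ℚ →ₗ[ℚ] FW ℚ :=
  Finsupp.linearCombination ℚ fun u =>
    Finsupp.linearCombination ℚ fun v => Finsupp.single (u ++ v) 1

theorem catW_eq_catL (x y : FW ℚ) : catW x y = catL x y := by
  simp [catW, catL, Finsupp.linearCombination_apply, Finsupp.sum, LinearMap.sum_apply,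
    Finset.smul_sum]

theorem catL_single (u v : List ℕ) (a b : ℚ) :
    catL (Finsupp.single u a) (Finsupp.single v b) = Finsupp.single (u ++ v) (a * b) := by
  simp [catL]

theorem catL_assoc (x y z : FW ℚ) : catL (catL x y) z = catL x (catL y z) := by
  induction x using Finsupp.induction_linear with
  | zero => simp
  | add _ _ h h' => simp only [map_add, LinearMap.add_apply, h, h']
  | single u a =>
    induction y using Finsupp.induction_linear with
    | zero => simp
    | add _ _ h h' => simp only [map_add, LinearMap.add_apply, h, h']
    | single v b =>
      induction z using Finsupp.induction_linear with
      | zero => simp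
      | add _ _ h h' => simp only [map_add, h, h']
      | single w c => simp only [catL_single, List.append_assoc, mul_assoc]

/-- `brakW` as a bilinear map. -/
noncomputable def brakL : FW ℚ →ₗ[ℚ] FW ℚ →ₗ[ℚ] FW ℚ := catL - catL.flip

theorem brakL_apply (x y : FW ℚ) : brakL x y = catL x y - catL y x := rfl

theorem brakW_eq_brakL (x y : FW ℚ) : brakW x y = brakL x y := by
  simp only [brakW, catW_eq_catL, brakL_apply]

theorem brakL_jacobi (x y z : FW ℚ) :
    brakL x (brakL y z) = brakL y (brakL x z) - brakL (brakL y x) z := by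
  simp only [brakL_apply, map_sub, LinearMap.sub_apply, catL_assoc]
  abel

theorem brakL_swap (x y : FW ℚ) : brakL x y = -brakL y x := by
  simp only [brakL_apply, neg_sub]

theorem mapDomain_brakL (f : ℕ → ℕ) (x y : FW ℚ) :
    (brakL x y).mapDomain (List.map f)
      = brakL (x.mapDomain (List.map f)) (y.mapDomain (List.map f)) := by
  have h (x y : FW ℚ) : (catL x y).mapDomain (List.map f)
      = catL (x.mapDomain (List.map f)) (y.mapDomain (List.map f)) := by
    induction x using Finsupp.induction_linear with
    | zero => simp
    | add _ _ h h' => simp only [map_add, LinearMap.add_apply, Finsupp.mapDomain_add, h, h']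
    | single u a =>
      induction y using Finsupp.induction_linear with
      | zero => simp
      | add _ _ h h' => simp only [map_add, Finsupp.mapDomain_add, h, h']
      | single v b => simp only [catL_single, Finsupp.mapDomain_single, List.map_append]
  simp only [brakL_apply, sub_eq_add_neg, Finsupp.mapDomain_add, h]
  rw [← h y x, ← neg_one_smul ℚ, Finsupp.mapDomain_smul, neg_one_smul]

theorem evalBT_map (f : ℕ → ℕ) (t : BT) (w : List ℕ) :
    (evalBT t (w.map f) : FW ℚ) = (evalBT t w : FW ℚ).mapDomain (List.map f) := by
  induction t generalizing w with
  | nil => simp [evalBT]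
  | nd l r ihl ihr =>
    simp only [evalBT, brakW_eq_brakL, mapDomain_brakL, ← ihl, ← ihr, List.map_take,
      List.map_drop]

theorem exists_append_of_mem_support_catW {x y : FW ℚ} {w : List ℕ}
    (h : w ∈ (catW x y).support) : ∃ u ∈ x.support, ∃ v ∈ y.support, w = u ++ v := by
  classical
  obtain ⟨u, hu, h⟩ := Finset.mem_biUnion.1 (Finsupp.support_sum h)
  obtain ⟨v, hv, h⟩ := Finset.mem_biUnion.1 (Finsupp.support_sum h)
  exact ⟨u, hu, v, hv, by simpa using Finsupp.support_single_subset h⟩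

theorem perm_of_mem_support_evalBT (t : BT) (w : List ℕ) {u : List ℕ}
    (h : u ∈ (evalBT t w : FW ℚ).support) : u.Perm w := by
  classical
  induction t generalizing w u with
  | nil =>
    rw [Finset.mem_singleton.1 (Finsupp.support_single_subset h)]
  | nd l r ihl ihr =>
    rw [← List.take_append_drop (l.nodes + 1) w]
    rcases Finset.mem_union.1 (Finsupp.support_sub h) with h | h
    · obtain ⟨a, ha, b, hb, rfl⟩ := exists_append_of_mem_support_catW h
      exact (ihl _ ha).append (ihr _ hb)
    · obtain ⟨a, ha, b, hb, rfl⟩ := exists_append_of_mem_support_catW h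
      exact List.perm_append_comm.trans ((ihl _ hb).append (ihr _ ha))

/-! ### Words on a finite alphabet -/

/-- The words in which each letter of `A` occurs exactly once. -/
noncomputable def words (A : Finset ℕ) : Finset (List ℕ) := A.toList.permutations.toFinset

theorem mem_words {A : Finset ℕ} {w : List ℕ} : w ∈ words A ↔ w.Nodup ∧ w.toFinset = A := by
  rw [words, List.mem_toFinset, List.mem_permutations]
  constructor
  · intro h
    exact ⟨h.nodup_iff.2 A.nodup_toList, by
      rw [List.toFinset_eq_of_perm _ _ h, Finset.toList_toFinset]⟩
  · rintro ⟨h, rfl⟩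
    exact (List.toFinset_toList h).symm

theorem permWords_eq_words (n : ℕ) : permWords n = words (Finset.Icc 1 n) := by
  ext w
  rw [mem_words, permWords, List.mem_toFinset, List.mem_permutations]
  have h : (List.range' 1 n).toFinset = Finset.Icc 1 n := by
    ext a
    simp
    omega
  constructor
  · intro hw
    exact ⟨hw.nodup_iff.2 (List.nodup_range' ..), by rw [List.toFinset_eq_of_perm _ _ hw, h]⟩
  · rintro ⟨hw, hw'⟩
    exact List.perm_of_nodup_nodup_toFinset_eq hw (List.nodup_range' ..) (hw'.trans h.symm)

theorem length_of_mem_words {A : Finset ℕ} {w : List ℕ} (h : w ∈ words A) :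
    w.length = A.card := by
  obtain ⟨hw, rfl⟩ := mem_words.1 h
  exact (List.toFinset_card_of_nodup hw).symm

theorem sum_words_split {M : Type*} [AddCommMonoid M] {A : Finset ℕ} {m : ℕ} (hm : m ≤ A.card)
    (f : List ℕ → List ℕ → M) :
    ∑ w ∈ words A, f (w.take m) (w.drop m)
      = ∑ B ∈ A.powersetCard m, ∑ u ∈ words B, ∑ v ∈ words (A \ B), f u v := by
  simp_rw [← Finset.sum_product', Finset.sum_sigma']
  refine Finset.sum_bij' (fun w _ => ⟨(w.take m).toFinset, (w.take m, w.drop m)⟩)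
    (fun p _ => p.2.1 ++ p.2.2) ?_ ?_ ?_ ?_ ?_
  · intro w hw
    have hl := length_of_mem_words hw
    obtain ⟨hw', rfl⟩ := mem_words.1 hw
    rw [← List.take_append_drop m w, List.nodup_append'] at hw'
    simp only [Finset.mem_sigma, Finset.mem_powersetCard, Finset.mem_product, mem_words]
    refine ⟨⟨fun a ha => ?_, ?_⟩, ⟨hw'.1, trivial⟩, hw'.2.1, ?_⟩
    · rw [List.mem_toFinset] at ha ⊢
      exact List.mem_of_mem_take ha
    · rw [List.toFinset_card_of_nodup hw'.1, List.length_take, hl]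
      omega
    · have h : w.toFinset = (w.take m).toFinset ∪ (w.drop m).toFinset := by
        rw [← List.toFinset_append, List.take_append_drop]
      rw [h, Finset.union_sdiff_left, Finset.sdiff_eq_self_of_disjoint]
      exact (List.disjoint_toFinset_iff_disjoint.2 hw'.2.2).symm
  · rintro ⟨B, u, v⟩ h
    simp only [Finset.mem_sigma, Finset.mem_powersetCard, Finset.mem_product, mem_words] at h
    obtain ⟨⟨hB, hm⟩, ⟨hu, rfl⟩, hv, hv'⟩ := h
    rw [mem_words, List.nodup_append', List.toFinset_append, hv']
    refine ⟨⟨hu, hv, ?_⟩, Finset.union_sdiff_of_subset hB⟩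
    rw [← List.disjoint_toFinset_iff_disjoint, hv']
    exact Finset.disjoint_sdiff
  · intro w _
    exact List.take_append_drop m w
  · rintro ⟨B, u, v⟩ h
    simp only [Finset.mem_sigma, Finset.mem_powersetCard, Finset.mem_product] at h
    have hl : u.length = m := (length_of_mem_words h.2.1).trans h.1.2
    have hB := (mem_words.1 h.2.1).2
    subst hl
    simp [hB]
  · intro w _
    rfl

/-! ### Admissible labellings -/

/-- Some element of `B` is a lower bound of `A`. -/
def HasLow (A B : Finset ℕ) : Prop := ∃ m ∈ B, ∀ a ∈ A, m ≤ a

/-- Some element of `B` is an upper bound of `A`. -/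
def HasHigh (A B : Finset ℕ) : Prop := ∃ m ∈ B, ∀ a ∈ A, a ≤ m

theorem minimum_eq_iff {u w : List ℕ} (hw : w ≠ []) (h : u ⊆ w) :
    u.minimum = w.minimum ↔ HasLow w.toFinset u.toFinset := by
  simp only [HasLow, List.mem_toFinset]
  constructor
  · intro he
    obtain ⟨m, hm⟩ := WithTop.ne_top_iff_exists.1 (List.minimum_ne_top_of_ne_nil hw)
    rw [← hm, List.minimum_eq_coe_iff] at he
    exact ⟨m, he.1, (List.minimum_eq_coe_iff.1 hm.symm).2⟩
  · rintro ⟨m, hm, hm'⟩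
    rw [List.minimum_eq_coe_iff.2 ⟨hm, fun a ha => hm' a (h ha)⟩,
      List.minimum_eq_coe_iff.2 ⟨h hm, hm'⟩]

theorem maximum_eq_iff {u w : List ℕ} (hw : w ≠ []) (h : u ⊆ w) :
    u.maximum = w.maximum ↔ HasHigh w.toFinset u.toFinset := by
  simp only [HasHigh, List.mem_toFinset]
  constructor
  · intro he
    obtain ⟨m, hm⟩ := WithBot.ne_bot_iff_exists.1 (List.maximum_ne_bot_of_ne_nil hw)
    rw [← hm, List.maximum_eq_coe_iff] at he
    exact ⟨m, he.1, (List.maximum_eq_coe_iff.1 hm.symm).2⟩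
  · rintro ⟨m, hm, hm'⟩
    rw [List.maximum_eq_coe_iff.2 ⟨hm, fun a ha => hm' a (h ha)⟩,
      List.maximum_eq_coe_iff.2 ⟨h hm, hm'⟩]

theorem admB_nd_iff (l r : BT) {w : List ℕ} (hw : w ≠ []) :
    admB (.nd l r) w = true ↔
      admB l (w.take (l.nodes + 1)) = true ∧ admB r (w.drop (l.nodes + 1)) = true
        ∧ HasLow w.toFinset (w.take (l.nodes + 1)).toFinset
        ∧ HasHigh w.toFinset (w.drop (l.nodes + 1)).toFinset := by
  simp only [admB, Bool.and_eq_true, decide_eq_true_eq,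
    minimum_eq_iff hw (List.take_subset _ _), maximum_eq_iff hw (List.drop_subset _ _), and_assoc]

theorem admB_map {f : ℕ → ℕ} (t : BT) {w : List ℕ} (hf : StrictMonoOn f {a | a ∈ w}) :
    admB t (w.map f) = true ↔ admB t w = true := by
  induction t generalizing w with
  | nil => simp [admB]
  | nd l r ihl ihr =>
    by_cases hw : w = []
    · simp [hw]
    have hl (a) (h : a ∈ w.take (l.nodes + 1)) : a ∈ w := List.mem_of_mem_take h
    have hr (a) (h : a ∈ w.drop (l.nodes + 1)) : a ∈ w := List.mem_of_mem_drop h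
    rw [admB_nd_iff l r hw, admB_nd_iff l r (by simpa using hw), ← List.map_take,
      ← List.map_drop, ihl (hf.mono hl), ihr (hf.mono hr)]
    simp only [HasLow, HasHigh, List.mem_toFinset, List.mem_map, exists_exists_and_eq_and,
      forall_exists_index, and_imp, forall_apply_eq_imp_iff₂]
    refine and_congr_right fun _ => and_congr_right fun _ => and_congr ?_ ?_
    · exact exists_congr fun m => and_congr_right fun hm => forall₂_congr fun a ha =>
        hf.le_iff_le (hl m hm) ha
    · exact exists_congr fun m => and_congr_right fun hm => forall₂_congr fun a ha =>
        hf.le_iff_le ha (hr m hm)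

/-- The analogue of `cElt` with the leaves labelled by the elements of `A`; it vanishes unless
there are as many labels as leaves. -/
noncomputable def wElt (t : BT) (A : Finset ℕ) : FW ℚ :=
  if A.card = t.nodes + 1 then ∑ w ∈ (words A).filter (fun w => admB t w = true), evalBT t w
  else 0

theorem cElt_eq_wElt {t : BT} {n : ℕ} (hn : n = t.nodes + 1) :
    (cElt t : FW ℚ) = wElt t (Finset.Icc 1 n) := by
  subst hn
  rw [cElt, wElt, if_pos (by simp), permWords_eq_words]

theorem wElt_of_card_ne {t : BT} {A : Finset ℕ} (h : A.card ≠ t.nodes + 1) : wElt t A = 0 :=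
  if_neg h

open scoped Classical in
theorem wElt_nd (l r : BT) (A : Finset ℕ) :
    wElt (.nd l r) A = ∑ B ∈ A.powerset with HasLow A B ∧ HasHigh A (A \ B),
      brakL (wElt l B) (wElt r (A \ B)) := by
  by_cases hA : A.card = l.nodes + r.nodes + 2
  · rw [wElt, if_pos (by simp only [BT.nodes]; omega), Finset.sum_filter]
    obtain ⟨f, hf⟩ : ∃ f : List ℕ → List ℕ → FW ℚ, ∀ u v, f u v =
        if admB l u = true ∧ admB r v = true ∧ HasLow A u.toFinset ∧ HasHigh A v.toFinset then
          brakL (evalBT l u) (evalBT r v) else 0 := ⟨_, fun _ _ => rfl⟩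
    have h₁ : ∀ w ∈ words A, (if admB (.nd l r) w = true then (evalBT (.nd l r) w : FW ℚ) else 0)
        = f (w.take (l.nodes + 1)) (w.drop (l.nodes + 1)) := by
      intro w hw
      have hl := length_of_mem_words hw
      have hw' : w ≠ [] := by
        rintro rfl
        simp only [List.length_nil] at hl
        omega
      obtain ⟨_, rfl⟩ := mem_words.1 hw
      simp only [admB_nd_iff l r hw', evalBT, brakW_eq_brakL, hf]
    rw [Finset.sum_congr rfl h₁, sum_words_split (by omega)]
    have h₂ : A.powersetCard (l.nodes + 1) = A.powerset.filter (fun B => B.card = l.nodes + 1) := by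
      ext B
      simp
    rw [h₂, Finset.sum_filter, Finset.sum_filter]
    refine Finset.sum_congr rfl fun B hB => ?_
    have hB := Finset.mem_powerset.1 hB
    by_cases hc : B.card = l.nodes + 1
    · have hc' : (A \ B).card = r.nodes + 1 := by
        rw [Finset.card_sdiff_of_subset hB]
        omega
      rw [if_pos hc, wElt, wElt, if_pos hc, if_pos hc']
      have h₃ : ∀ u ∈ words B, ∀ v ∈ words (A \ B), f u v
          = if HasLow A B ∧ HasHigh A (A \ B) then
              if admB l u = true then if admB r v = true then
                brakL (evalBT l u) (evalBT r v) else 0 else 0 else 0 := by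
        intro u hu v hv
        rw [hf, (mem_words.1 hu).2, (mem_words.1 hv).2]
        by_cases a₁ : HasLow A B <;> by_cases a₂ : HasHigh A (A \ B) <;>
          by_cases a₃ : admB l u = true <;> by_cases a₄ : admB r v = true <;>
          simp [a₁, a₂, a₃, a₄]
      rw [Finset.sum_congr rfl fun u hu => Finset.sum_congr rfl (h₃ u hu)]
      split_ifs with hP
      · simp only [map_sum, LinearMap.sum_apply, Finset.sum_filter]
        rw [Finset.sum_comm]
        refine Finset.sum_congr rfl fun u _ => Finset.sum_congr rfl fun v _ => ?_
        split_ifs <;> simp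
      · simp
    · rw [if_neg hc, wElt_of_card_ne hc]
      simp
  · rw [wElt_of_card_ne (by simp only [BT.nodes]; omega), Finset.sum_eq_zero]
    intro B hB
    have hB := Finset.mem_powerset.1 (Finset.mem_filter.1 hB).1
    have h := Finset.card_sdiff_add_card_eq_card hB
    by_cases hc : B.card = l.nodes + 1
    · rw [wElt_of_card_ne (A := A \ B) (by omega), map_zero]
    · rw [wElt_of_card_ne hc, map_zero, LinearMap.zero_apply]

/-! ### The preLie product on the elements `wElt` -/

theorem hasLow_trans_iff {A X Y : Finset ℕ} (hX : X ⊆ Y) (hY : Y ⊆ A) :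
    HasLow A Y ∧ HasLow Y X ↔ HasLow A X := by
  constructor
  · rintro ⟨⟨m, hm, hm'⟩, n, hn, hn'⟩
    exact ⟨n, hn, fun a ha => (hn' m hm).trans (hm' a ha)⟩
  · rintro ⟨m, hm, hm'⟩
    exact ⟨⟨m, hX hm, hm'⟩, m, hm, fun a ha => hm' a (hY ha)⟩

theorem hasHigh_trans_iff {A X Y : Finset ℕ} (hX : X ⊆ Y) (hY : Y ⊆ A) :
    HasHigh A Y ∧ HasHigh Y X ↔ HasHigh A X := by
  constructor
  · rintro ⟨⟨m, hm, hm'⟩, n, hn, hn'⟩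
    exact ⟨n, hn, fun a ha => (hm' a ha).trans (hn' m hm)⟩
  · rintro ⟨m, hm, hm'⟩
    exact ⟨⟨m, hX hm, hm'⟩, m, hm, fun a ha => hm' a (hY ha)⟩

theorem hasLow_iff_min'_mem {A X : Finset ℕ} (hA : A.Nonempty) (hX : X ⊆ A) :
    HasLow A X ↔ A.min' hA ∈ X := by
  constructor
  · rintro ⟨m, hm, hm'⟩
    rwa [← le_antisymm (hm' _ (A.min'_mem hA)) (A.min'_le _ (hX hm))]
  · exact fun h => ⟨_, h, fun a ha => A.min'_le a ha⟩

theorem hasHigh_iff_max'_mem {A X : Finset ℕ} (hA : A.Nonempty) (hX : X ⊆ A) :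
    HasHigh A X ↔ A.max' hA ∈ X := by
  constructor
  · rintro ⟨m, hm, hm'⟩
    rwa [le_antisymm (hm' _ (A.max'_mem hA)) (A.le_max' _ (hX hm))]
  · exact fun h => ⟨_, h, fun a ha => A.le_max' a ha⟩

theorem hasLow_sdiff_iff {A X : Finset ℕ} (hA : A.Nonempty) (hX : X ⊆ A) :
    HasLow A (A \ X) ↔ ¬HasLow A X := by
  simp [hasLow_iff_min'_mem hA hX, hasLow_iff_min'_mem hA Finset.sdiff_subset,
    A.min'_mem hA]

theorem hasHigh_sdiff_iff {A X : Finset ℕ} (hA : A.Nonempty) (hX : X ⊆ A) :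
    HasHigh A (A \ X) ↔ ¬HasHigh A X := by
  simp [hasHigh_iff_max'_mem hA hX, hasHigh_iff_max'_mem hA Finset.sdiff_subset,
    A.max'_mem hA]

section

open scoped Classical

theorem sum_hasHigh_eq_add (x s : BT) (A : Finset ℕ) :
    ∑ B ∈ A.powerset with HasHigh A (A \ B), brakL (wElt x B) (wElt s (A \ B))
      = wElt (.nd x s) A + ∑ B ∈ A.powerset with HasLow A (A \ B) ∧ HasHigh A (A \ B),
          brakL (wElt x B) (wElt s (A \ B)) := by
  rw [wElt_nd, ← Finset.sum_filter_add_sum_filter_not _ (fun B => HasLow A B),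
    Finset.filter_filter, Finset.filter_filter]
  congr 1
  · simp only [and_comm]
  · refine Finset.sum_congr (Finset.filter_congr fun B hB => ?_) fun _ _ => rfl
    rw [and_comm]
    refine and_congr_left fun h => (hasLow_sdiff_iff ?_ (Finset.mem_powerset.1 hB)).symm
    obtain ⟨m, hm, -⟩ := h
    exact ⟨m, (Finset.mem_sdiff.1 hm).1⟩

theorem sum_hasLow_eq_sub (x l : BT) (A : Finset ℕ) :
    ∑ B ∈ A.powerset with HasLow A (A \ B), brakL (wElt l (A \ B)) (wElt x B)
      = wElt (.nd l x) A - ∑ B ∈ A.powerset with HasLow A (A \ B) ∧ HasHigh A (A \ B),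
          brakL (wElt x B) (wElt l (A \ B)) := by
  rw [wElt_nd, ← Finset.sum_filter_not_add_sum_filter _ (fun B => HasHigh A (A \ B)),
    Finset.filter_filter, Finset.filter_filter, sub_eq_add_neg, ← Finset.sum_neg_distrib]
  congr 1
  · refine Finset.sum_bij' (fun B _ => A \ B) (fun B _ => A \ B) ?_ ?_ ?_ ?_ ?_
    · intro B hB
      simp only [Finset.mem_filter, Finset.mem_powerset] at hB ⊢
      obtain ⟨hB, h, h'⟩ := hB
      refine ⟨Finset.sdiff_subset, h, ?_⟩
      obtain ⟨m, hm, -⟩ := h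
      rw [hasHigh_sdiff_iff ⟨m, (Finset.mem_sdiff.1 hm).1⟩ Finset.sdiff_subset]
      exact h'
    · intro B hB
      simp only [Finset.mem_filter, Finset.mem_powerset] at hB ⊢
      obtain ⟨hB, h, h'⟩ := hB
      refine ⟨Finset.sdiff_subset, by rwa [Finset.sdiff_sdiff_eq_self hB], ?_⟩
      obtain ⟨m, hm, -⟩ := h
      rwa [← hasHigh_sdiff_iff ⟨m, hB hm⟩ Finset.sdiff_subset, Finset.sdiff_sdiff_eq_self hB]
    · intro B hB
      exact Finset.sdiff_sdiff_eq_self (Finset.mem_powerset.1 (Finset.mem_filter.1 hB).1)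
    · intro B hB
      exact Finset.sdiff_sdiff_eq_self (Finset.mem_powerset.1 (Finset.mem_filter.1 hB).1)
    · intro B hB
      rw [Finset.sdiff_sdiff_eq_self (Finset.mem_powerset.1 (Finset.mem_filter.1 hB).1)]
  · exact Finset.sum_congr rfl fun B _ => brakL_swap _ _

theorem sum_hasLow_hasHigh_eq_graft (x s : BT) (A : Finset ℕ) :
    ∑ B ∈ A.powerset with HasLow A (A \ B) ∧ HasHigh A (A \ B),
        brakL (wElt x B) (wElt s (A \ B))
      = graft (fun u => wElt u A) x s := by
  induction s generalizing A with
  | nil =>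
    refine Finset.sum_eq_zero fun B hB => ?_
    simp only [Finset.mem_filter, Finset.mem_powerset] at hB
    obtain ⟨hB, ⟨m, hm, hm'⟩, n, hn, hn'⟩ := hB
    by_cases h : (A \ B).card = 1
    · have hnm : n = m := Finset.card_le_one.1 h.le n hn m hm
      have hA : A ⊆ A \ B := fun a ha => by rwa [le_antisymm (hnm ▸ hn' a ha) (hm' a ha)]
      have hB' : B.card = 0 := by
        have := Finset.card_le_card hA
        have := Finset.card_sdiff_add_card_eq_card hB
        omega
      rw [wElt_of_card_ne (A := B) (by omega), map_zero, LinearMap.zero_apply]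
    · rw [wElt_of_card_ne (A := A \ B) (by simpa [BT.nodes] using h), map_zero]
  | nd l r ihl ihr =>
    have h₁ : ∑ B ∈ A.powerset with HasLow A (A \ B) ∧ HasHigh A (A \ B),
        ∑ C ∈ (A \ B).powerset with HasLow (A \ B) C ∧ HasHigh (A \ B) ((A \ B) \ C),
          brakL (wElt l C) (brakL (wElt x B) (wElt r ((A \ B) \ C)))
        = wElt (.nd l (.nd x r)) A + graft (fun u => wElt (.nd l u) A) x r := by
      have h : ∀ C, brakL (wElt l C) (wElt (.nd x r) (A \ C))
            + graft (fun u => brakL (wElt l C) (wElt u (A \ C))) x r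
          = ∑ B ∈ (A \ C).powerset with HasHigh (A \ C) ((A \ C) \ B),
            brakL (wElt l C) (brakL (wElt x B) (wElt r ((A \ C) \ B))) := by
        intro C
        rw [← map_sum, sum_hasHigh_eq_add, ihr, map_add]
        congr 1
        exact (map_graft (brakL (wElt l C)).toAddMonoidHom _ x r).symm
      simp only [wElt_nd l, graft_sum]
      rw [← Finset.sum_add_distrib]
      simp only [h]
      rw [Finset.sum_comm' (t' := A.powerset.filter fun C => HasLow A C ∧ HasHigh A (A \ C))
        (s' := fun C => (A \ C).powerset.filter fun B => HasHigh (A \ C) ((A \ C) \ B))]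
      · exact Finset.sum_congr rfl fun C _ => Finset.sum_congr rfl fun B _ => by
          rw [sdiff_right_comm]
      intro B C
      simp only [Finset.mem_filter, Finset.mem_powerset]
      have hs : B ⊆ A ∧ C ⊆ A \ B ↔ C ⊆ A ∧ B ⊆ A \ C := by
        simp only [Finset.subset_sdiff, disjoint_comm (a := B)]
        tauto
      constructor
      · rintro ⟨⟨hB, h, h'⟩, hC, k, k'⟩
        obtain ⟨hC', hB'⟩ := hs.1 ⟨hB, hC⟩
        have h₁ := (hasHigh_trans_iff Finset.sdiff_subset Finset.sdiff_subset).1 ⟨h', k'⟩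
        rw [sdiff_right_comm, ← hasHigh_trans_iff Finset.sdiff_subset Finset.sdiff_subset] at h₁
        exact ⟨⟨hB', h₁.2⟩, hC', (hasLow_trans_iff hC Finset.sdiff_subset).1 ⟨h, k⟩, h₁.1⟩
      · rintro ⟨⟨hB, h⟩, hC, k, k'⟩
        obtain ⟨hB', hC'⟩ := hs.2 ⟨hC, hB⟩
        have h₁ := (hasHigh_trans_iff Finset.sdiff_subset Finset.sdiff_subset).1 ⟨k', h⟩
        rw [sdiff_right_comm, ← hasHigh_trans_iff Finset.sdiff_subset Finset.sdiff_subset] at h₁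
        have h₂ := (hasLow_trans_iff hC' Finset.sdiff_subset).2 k
        exact ⟨⟨hB', h₂.1, h₁.1⟩, hC', h₂.2, h₁.2⟩
    have h₂ : ∑ B ∈ A.powerset with HasLow A (A \ B) ∧ HasHigh A (A \ B),
        ∑ C ∈ (A \ B).powerset with HasLow (A \ B) C ∧ HasHigh (A \ B) ((A \ B) \ C),
          brakL (brakL (wElt l C) (wElt x B)) (wElt r ((A \ B) \ C))
        = wElt (.nd (.nd l x) r) A - graft (fun u => wElt (.nd u r) A) x l := by
      have h : ∀ E, brakL (wElt (.nd l x) E) (wElt r (A \ E))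
            - graft (fun u => brakL (wElt u E) (wElt r (A \ E))) x l
          = ∑ B ∈ E.powerset with HasLow E (E \ B),
            brakL (brakL (wElt l (E \ B)) (wElt x B)) (wElt r (A \ E)) := by
        intro E
        rw [← LinearMap.sum_apply, ← map_sum, sum_hasLow_eq_sub, ihl, map_sub,
          LinearMap.sub_apply]
        congr 1
        exact (map_graft (brakL.flip (wElt r (A \ E))).toAddMonoidHom _ x l).symm
      simp only [wElt_nd _ r, graft_sum]
      rw [← Finset.sum_sub_distrib]
      simp only [h]
      rw [Finset.sum_sigma', Finset.sum_sigma']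
      refine Finset.sum_bij' (fun p _ => ⟨p.1 ∪ p.2, p.1⟩) (fun p _ => ⟨p.2, p.1 \ p.2⟩)
        ?_ ?_ ?_ ?_ ?_
      · rintro ⟨B, C⟩ hp
        simp only [Finset.mem_sigma, Finset.mem_filter, Finset.mem_powerset] at hp ⊢
        obtain ⟨⟨hB, h, h'⟩, hC, k, k'⟩ := hp
        have hd : Disjoint B C := (Finset.subset_sdiff.1 hC).2.symm
        have hE : B ∪ C ⊆ A := Finset.union_subset hB (hC.trans Finset.sdiff_subset)
        rw [Finset.union_sdiff_cancel_left hd, ← Finset.sup_eq_union, ← sdiff_sdiff,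
          Finset.sup_eq_union]
        have h₁ := (hasLow_trans_iff hC Finset.sdiff_subset).1 ⟨h, k⟩
        rw [← hasLow_trans_iff Finset.subset_union_right hE] at h₁
        exact ⟨⟨hE, h₁.1, (hasHigh_trans_iff Finset.sdiff_subset Finset.sdiff_subset).1 ⟨h', k'⟩⟩,
          Finset.subset_union_left, h₁.2⟩
      · rintro ⟨E, B⟩ hp
        simp only [Finset.mem_sigma, Finset.mem_filter, Finset.mem_powerset] at hp ⊢
        obtain ⟨⟨hE, h, h'⟩, hB, k⟩ := hp
        have hD : (A \ B) \ (E \ B) = A \ E := by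
          rw [sdiff_sdiff, Finset.sup_eq_union, Finset.union_sdiff_of_subset hB]
        have hC : E \ B ⊆ A \ B := Finset.sdiff_subset_sdiff hE subset_rfl
        have h₁ := (hasLow_trans_iff Finset.sdiff_subset hE).1 ⟨h, k⟩
        rw [← hasLow_trans_iff hC Finset.sdiff_subset] at h₁
        have h₂ := h'
        rw [← hD, ← hasHigh_trans_iff Finset.sdiff_subset Finset.sdiff_subset] at h₂
        exact ⟨⟨hB.trans hE, h₁.1, h₂.1⟩, hC, h₁.2, h₂.2⟩
      · rintro ⟨B, C⟩ hp
        simp only [Finset.mem_sigma, Finset.mem_filter, Finset.mem_powerset] at hp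
        have hd : Disjoint B C := (Finset.subset_sdiff.1 hp.2.1).2.symm
        simp only [Finset.union_sdiff_cancel_left hd]
      · rintro ⟨E, B⟩ hp
        simp only [Finset.mem_sigma, Finset.mem_filter, Finset.mem_powerset] at hp
        simp only [Finset.union_sdiff_of_subset hp.2.1]
      · rintro ⟨B, C⟩ hp
        simp only [Finset.mem_sigma, Finset.mem_filter, Finset.mem_powerset] at hp
        have hd : Disjoint B C := (Finset.subset_sdiff.1 hp.2.1).2.symm
        simp only [Finset.union_sdiff_cancel_left hd, sdiff_sdiff, Finset.sup_eq_union]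
    simp only [wElt_nd l r, map_sum, brakL_jacobi (wElt x _), Finset.sum_sub_distrib]
    rw [h₁, h₂, graft]
    abel

end

/-! ### Standardization -/

/-- The number of elements of `A` that are at most `a`. -/
def rank (A : Finset ℕ) (a : ℕ) : ℕ := (A.filter (· ≤ a)).card

theorem stdW_eq_map_rank {A : Finset ℕ} {w : List ℕ} (hw : w ∈ words A) :
    stdW w = w.map (rank A) := by
  obtain ⟨hw', rfl⟩ := mem_words.1 hw
  refine List.map_congr_left fun a _ => ?_
  rw [rank, ← List.toFinset_card_of_nodup (hw'.filter _), List.toFinset_filter]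
  simp

theorem strictMonoOn_rank (A : Finset ℕ) : StrictMonoOn (rank A) A := by
  intro a _ b hb hab
  refine Finset.card_lt_card ((Finset.ssubset_iff_of_subset ?_).2 ⟨b, ?_, ?_⟩)
  · exact Finset.monotone_filter_right _ fun c _ hc => le_trans hc hab.le
  · simpa using hb
  · simp [hab]

theorem image_rank (A : Finset ℕ) : A.image (rank A) = Finset.Icc 1 A.card := by
  refine Finset.eq_of_subset_of_card_le ?_ ?_
  · intro k hk
    obtain ⟨a, ha, rfl⟩ := Finset.mem_image.1 hk
    rw [Finset.mem_Icc]
    exact ⟨Finset.card_pos.2 ⟨a, by simpa using ha⟩, Finset.card_filter_le _ _⟩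
  · rw [Finset.card_image_of_injOn (strictMonoOn_rank A).injOn]
    simp

theorem length_of_mem_permWords {n : ℕ} {u : List ℕ} (hu : u ∈ permWords n) : u.length = n := by
  rw [permWords_eq_words] at hu
  simpa using length_of_mem_words hu

theorem injOn_map {A : Finset ℕ} {f : ℕ → ℕ} (hf : Set.InjOn f A) :
    Set.InjOn (List.map f) (words A : Set (List ℕ)) := by
  intro u hu v hv h
  have key {w : List ℕ} (hw : w ∈ words A) : (w.map f).map (Function.invFunOn f A) = w := by
    rw [List.map_map]
    refine (List.map_congr_left fun a ha => hf.leftInvOn_invFunOn ?_).trans (List.map_id w)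
    rw [← (mem_words.1 hw).2]
    simpa using ha
  rw [← key hu, h, key hv]

theorem words_image {A : Finset ℕ} {f : ℕ → ℕ} (hf : Set.InjOn f A) :
    words (A.image f) = (words A).image (List.map f) := by
  ext w
  simp only [Finset.mem_image, mem_words]
  constructor
  · rintro ⟨hw, hA⟩
    have hw' : ∀ b ∈ w, Function.invFunOn f A b ∈ A ∧ f (Function.invFunOn f A b) = b := by
      intro b hb
      rw [← List.mem_toFinset, hA] at hb
      obtain ⟨a, ha, rfl⟩ := Finset.mem_image.1 hb
      exact Function.invFunOn_pos ⟨a, ha, rfl⟩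
    have hw'' : (w.map (Function.invFunOn f A)).map f = w := by
      rw [List.map_map]
      exact (List.map_congr_left fun b hb => (hw' b hb).2).trans (List.map_id w)
    refine ⟨w.map (Function.invFunOn f A), ⟨?_, ?_⟩, hw''⟩
    · rw [← hw''] at hw
      exact hw.of_map f
    · ext a
      simp only [List.mem_toFinset, List.mem_map]
      constructor
      · rintro ⟨b, hb, rfl⟩
        exact (hw' b hb).1
      · intro ha
        have hb : f a ∈ w := by
          rw [← List.mem_toFinset, hA]
          exact Finset.mem_image_of_mem f ha
        exact ⟨f a, hb, hf (hw' _ hb).1 ha (hw' _ hb).2⟩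
  · rintro ⟨u, ⟨hu, rfl⟩, rfl⟩
    refine ⟨(List.nodup_map_iff_inj_on hu).2 fun a ha b hb h => hf ?_ ?_ h, ?_⟩
    · simpa using ha
    · simpa using hb
    · ext a
      simp

theorem stdW_mem_permWords {A : Finset ℕ} {w : List ℕ} (hw : w ∈ words A) :
    stdW w ∈ permWords A.card := by
  rw [permWords_eq_words, ← image_rank, words_image (strictMonoOn_rank A).injOn,
    stdW_eq_map_rank hw]
  exact Finset.mem_image_of_mem _ hw

theorem support_wElt_subset (t : BT) (A : Finset ℕ) : (wElt t A).support ⊆ words A := by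
  classical
  intro u hu
  rw [wElt] at hu
  split_ifs at hu with h
  · obtain ⟨w, hw, hu⟩ := Finset.mem_biUnion.1 (Finsupp.support_finsetSum hu)
    have hp := perm_of_mem_support_evalBT t w hu
    obtain ⟨hw', rfl⟩ := mem_words.1 (Finset.mem_filter.1 hw).1
    exact mem_words.2 ⟨hp.nodup_iff.2 hw', List.toFinset_eq_of_perm _ _ hp⟩
  · simp at hu

theorem support_cElt_subset (t : BT) : (cElt t : FW ℚ).support ⊆ permWords (t.nodes + 1) := by
  rw [cElt_eq_wElt rfl, permWords_eq_words]
  exact support_wElt_subset t _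

theorem cElt_eq_mapDomain_wElt {t : BT} {A : Finset ℕ} (hA : A.card = t.nodes + 1) :
    (cElt t : FW ℚ) = (wElt t A).mapDomain (List.map (rank A)) := by
  have hinj := (strictMonoOn_rank A).injOn
  rw [cElt, wElt, if_pos hA, permWords_eq_words, ← hA, ← image_rank, words_image hinj,
    Finset.sum_filter, Finset.sum_image (injOn_map hinj), Finset.sum_filter,
    Finsupp.mapDomain_finsetSum]
  refine Finset.sum_congr rfl fun w hw => ?_
  have hw' : StrictMonoOn (rank A) {a | a ∈ w} := by
    refine (strictMonoOn_rank A).mono fun a ha => ?_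
    rw [← (mem_words.1 hw).2]
    simpa using ha
  simp only [admB_map t hw', evalBT_map]
  split_ifs <;> simp

theorem cElt_stdW {t : BT} {A : Finset ℕ} (hA : A.card = t.nodes + 1) {w : List ℕ}
    (hw : w ∈ words A) : (cElt t : FW ℚ) (stdW w) = wElt t A w := by
  rw [cElt_eq_mapDomain_wElt hA, stdW_eq_map_rank hw]
  exact Finsupp.mapDomain_apply' (words A : Set (List ℕ)) _
    (Finset.coe_subset.2 (support_wElt_subset t A)) (injOn_map (strictMonoOn_rank A).injOn)
    (Finset.mem_coe.2 hw)

theorem catL_eq_sum {x y : FW ℚ} {S T : Finset (List ℕ)} (hx : x.support ⊆ S)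
    (hy : y.support ⊆ T) :
    catL x y = ∑ u ∈ S, ∑ v ∈ T, (x u * y v) • Finsupp.single (u ++ v) 1 := by
  rw [← catW_eq_catL, catW, Finsupp.sum_of_support_subset _ hx _ (by simp)]
  refine Finset.sum_congr rfl fun u _ => ?_
  rw [Finsupp.sum_of_support_subset _ hy _ (by simp)]
  simp

theorem sum_sum_shuffle (x s : BT) (P : Finset ℕ → Prop) [DecidablePred P] :
    ((cElt x : FW ℚ).sum fun u a => (cElt s : FW ℚ).sum fun v b => (a * b) •
        ∑ γ ∈ (permWords (u.length + v.length)).filter (fun γ =>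
          stdW (γ.take u.length) = u ∧ stdW (γ.drop u.length) = v
            ∧ P (γ.take u.length).toFinset), (Finsupp.single γ 1 : FW ℚ))
      = ∑ B ∈ (Finset.Icc 1 (x.nodes + s.nodes + 2)).powerset with P B,
          catL (wElt x B) (wElt s (Finset.Icc 1 (x.nodes + s.nodes + 2) \ B)) := by
  obtain ⟨A, hA⟩ : ∃ A, A = Finset.Icc 1 (x.nodes + s.nodes + 2) := ⟨_, rfl⟩
  have hAc : A.card = x.nodes + s.nodes + 2 := by simp [hA]
  obtain ⟨f, hf⟩ : ∃ f : List ℕ → List ℕ → FW ℚ, ∀ u v, f u v = if P u.toFinset then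
      ((cElt x : FW ℚ) (stdW u) * (cElt s : FW ℚ) (stdW v)) • Finsupp.single (u ++ v) 1
      else 0 := ⟨_, fun _ _ => rfl⟩
  have h₁ : ∀ γ ∈ words A, ∑ u ∈ permWords (x.nodes + 1), ∑ v ∈ permWords (s.nodes + 1),
      (if stdW (γ.take (x.nodes + 1)) = u ∧ stdW (γ.drop (x.nodes + 1)) = v
        ∧ P (γ.take (x.nodes + 1)).toFinset then
          ((cElt x : FW ℚ) u * (cElt s : FW ℚ) v) • (Finsupp.single γ 1 : FW ℚ) else 0)
      = f (γ.take (x.nodes + 1)) (γ.drop (x.nodes + 1)) := by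
    intro γ hγ
    have hlen := length_of_mem_words hγ
    have hnd := (mem_words.1 hγ).1
    have hstd {w : List ℕ} {n : ℕ} (hw : w.Nodup) (hn : w.length = n) : stdW w ∈ permWords n := by
      have := stdW_mem_permWords (mem_words.2 ⟨hw, rfl⟩)
      rwa [List.toFinset_card_of_nodup hw, hn] at this
    have ht := hstd (n := x.nodes + 1) (hnd.take (i := x.nodes + 1)) (by
      rw [List.length_take]; omega)
    have hd := hstd (n := s.nodes + 1) (hnd.drop (i := x.nodes + 1)) (by
      rw [List.length_drop]; omega)
    simp only [hf, ite_and, Finset.sum_ite_eq, Finset.sum_ite_irrel, Finset.sum_const_zero,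
      ht, hd, if_true, List.take_append_drop]
  rw [← hA, Finsupp.sum_of_support_subset _ (support_cElt_subset x) _ (by simp)]
  trans ∑ γ ∈ words A, f (γ.take (x.nodes + 1)) (γ.drop (x.nodes + 1))
  · rw [← Finset.sum_congr rfl h₁, Finset.sum_comm]
    refine Finset.sum_congr rfl fun u hu => ?_
    rw [Finsupp.sum_of_support_subset _ (support_cElt_subset s) _ (by simp), Finset.sum_comm]
    refine Finset.sum_congr rfl fun v hv => ?_
    rw [length_of_mem_permWords hu, length_of_mem_permWords hv, Finset.sum_filter,
      Finset.smul_sum, permWords_eq_words, hA]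
    rw [show x.nodes + 1 + (s.nodes + 1) = x.nodes + s.nodes + 2 by ring]
    simp only [smul_ite, smul_zero]
  · rw [sum_words_split (by omega)]
    have h₂ : A.powersetCard (x.nodes + 1) = A.powerset.filter (fun B => B.card = x.nodes + 1) := by
      ext B
      simp
    rw [h₂, Finset.sum_filter, Finset.sum_filter]
    refine Finset.sum_congr rfl fun B hB => ?_
    have hB := Finset.mem_powerset.1 hB
    by_cases hc : B.card = x.nodes + 1
    · have hc' : (A \ B).card = s.nodes + 1 := by
        rw [Finset.card_sdiff_of_subset hB]
        omega
      rw [if_pos hc, catL_eq_sum (support_wElt_subset x B) (support_wElt_subset s _)]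
      have h₃ : ∀ u ∈ words B, ∀ v ∈ words (A \ B), f u v = if P B then
          (wElt x B u * wElt s (A \ B) v) • Finsupp.single (u ++ v) 1 else 0 := by
        intro u hu v hv
        rw [hf, (mem_words.1 hu).2, cElt_stdW hc hu, cElt_stdW hc' hv]
      rw [Finset.sum_congr rfl fun u hu => Finset.sum_congr rfl (h₃ u hu)]
      split_ifs <;> simp
    · rw [if_neg hc, wElt_of_card_ne hc]
      simp

/-! ### The preLie product -/

theorem succExt_cElt (x s : BT) :
    succExt (cElt x : FW ℚ) (cElt s) = ∑ B ∈ (Finset.Icc 1 (x.nodes + s.nodes + 2)).powerset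
        with x.nodes + s.nodes + 2 ∉ B,
      catL (wElt x B) (wElt s (Finset.Icc 1 (x.nodes + s.nodes + 2) \ B)) := by
  refine Eq.trans ?_ (sum_sum_shuffle x s (fun B => x.nodes + s.nodes + 2 ∉ B))
  refine Finsupp.sum_congr fun u hu => Finsupp.sum_congr fun v hv => ?_
  rw [succW]
  congr 1
  refine Finset.sum_congr (Finset.filter_congr fun γ hγ => ?_) fun _ _ => rfl
  refine and_congr_right fun _ => and_congr_right fun _ => ?_
  rw [length_of_mem_permWords (support_cElt_subset x hu),
    length_of_mem_permWords (support_cElt_subset s hv), permWords_eq_words, mem_words] at hγ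
  rw [length_of_mem_permWords (support_cElt_subset x hu),
    length_of_mem_permWords (support_cElt_subset s hv), List.mem_toFinset,
    show x.nodes + 1 + (s.nodes + 1) = x.nodes + s.nodes + 2 by ring]
  have hN : x.nodes + s.nodes + 2 ∈ γ := by
    rw [← List.mem_toFinset, hγ.2, Finset.mem_Icc]
    omega
  have hnd := hγ.1
  rw [← List.take_append_drop (x.nodes + 1) γ] at hN hnd
  exact ⟨fun h h' => (List.nodup_append'.1 hnd).2.2 h' h, (List.mem_append.1 hN).resolve_left⟩

theorem precExt_cElt (x s : BT) :
    precExt (cElt x : FW ℚ) (cElt s) = ∑ B ∈ (Finset.Icc 1 (x.nodes + s.nodes + 2)).powerset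
        with x.nodes + s.nodes + 2 ∈ B,
      catL (wElt x B) (wElt s (Finset.Icc 1 (x.nodes + s.nodes + 2) \ B)) := by
  refine Eq.trans ?_ (sum_sum_shuffle x s (fun B => x.nodes + s.nodes + 2 ∈ B))
  refine Finsupp.sum_congr fun u hu => Finsupp.sum_congr fun v hv => ?_
  rw [precW]
  congr 1
  refine Finset.sum_congr (Finset.filter_congr fun γ _ => ?_) fun _ _ => rfl
  rw [List.mem_toFinset, length_of_mem_permWords (support_cElt_subset x hu),
    length_of_mem_permWords (support_cElt_subset s hv),
    show x.nodes + 1 + (s.nodes + 1) = x.nodes + s.nodes + 2 by ring]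

theorem preLieW_cElt (x s : BT) :
    preLieW (cElt x : FW ℚ) (cElt s) = cElt (.nd x s) + graft (fun u => (cElt u : FW ℚ)) x s := by
  classical
  obtain ⟨A, hA⟩ : ∃ A, A = Finset.Icc 1 (x.nodes + s.nodes + 2) := ⟨_, rfl⟩
  have hc : graft (fun u => (cElt u : FW ℚ)) x s = graft (fun u => wElt u A) x s := by
    refine graft_congr fun u hu => ?_
    rw [hA, cElt_eq_wElt (n := x.nodes + s.nodes + 2) (by omega)]
  have hn : x.nodes + s.nodes + 2 ∈ A := by simp [hA]
  have hhigh {X : Finset ℕ} (hX : X ⊆ A) : HasHigh A X ↔ x.nodes + s.nodes + 2 ∈ X := by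
    constructor
    · rintro ⟨m, hm, hm'⟩
      have h₁ := hm' _ hn
      have h₂ := hX hm
      rw [hA, Finset.mem_Icc] at h₂
      rwa [le_antisymm h₁ h₂.2]
    · refine fun h => ⟨_, h, fun a ha => ?_⟩
      rw [hA, Finset.mem_Icc] at ha
      exact ha.2
  rw [hc, cElt_eq_wElt (t := .nd x s) (n := x.nodes + s.nodes + 2) (by simp only [BT.nodes]),
    ← hA, ← sum_hasLow_hasHigh_eq_graft, ← sum_hasHigh_eq_add, preLieW, succExt_cElt,
    precExt_cElt, add_comm s.nodes, ← hA]
  simp only [brakL_apply, Finset.sum_sub_distrib]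
  congr 1
  · refine Finset.sum_congr (Finset.filter_congr fun B hB => ?_) fun _ _ => rfl
    rw [hhigh Finset.sdiff_subset, Finset.mem_sdiff]
    simp [hn]
  · refine Finset.sum_bij' (fun B _ => A \ B) (fun B _ => A \ B) ?_ ?_ ?_ ?_ ?_
    all_goals
      intro B hB
      simp only [Finset.mem_filter, Finset.mem_powerset] at hB ⊢
      have hB' := Finset.sdiff_sdiff_eq_self hB.1
    · rw [hB', hhigh hB.1]
      exact ⟨Finset.sdiff_subset, hB.2⟩
    · exact ⟨Finset.sdiff_subset, (hhigh Finset.sdiff_subset).1 hB.2⟩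
    · exact hB'
    · exact hB'
    · rw [hB']

/-! ### Sums over L-classes -/

theorem linearCombination_cElt_mem_span {w : BT →₀ ℚ} (hw : ∀ t t', LIn t t' → w t = w t') :
    Finsupp.linearCombination ℚ (fun t => (cElt t : FW ℚ)) w
      ∈ Submodule.span ℚ (Set.range LclassSum) := by
  classical
  have hw' (t t') (h : LEquiv t t') : w t = w t' := by
    induction h with
    | rel _ _ h => exact hw _ _ h
    | refl => rfl
    | symm _ _ _ ih => exact ih.symm
    | trans _ _ _ _ _ ih ih' => exact ih.trans ih'
  rw [Finsupp.linearCombination_apply, Finsupp.sum,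
    ← Finset.sum_fiberwise_of_maps_to (t := w.support.image (Quotient.mk lSetoid))
      (g := Quotient.mk lSetoid) fun t ht => Finset.mem_image_of_mem _ ht]
  refine Submodule.sum_mem _ fun q hq => ?_
  obtain ⟨t, ht, rfl⟩ := Finset.mem_image.1 hq
  have h : ∑ s ∈ w.support with Quotient.mk lSetoid s = Quotient.mk lSetoid t, w s • (cElt s : FW ℚ)
      = w t • LclassSum t := by
    rw [LclassSum, Finset.smul_sum]
    refine Finset.sum_congr ?_ fun s hs => ?_
    · ext s
      simp only [Finset.mem_filter, mem_allBT, Finsupp.mem_support_iff]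
      have hq : Quotient.mk lSetoid s = Quotient.mk lSetoid t ↔ LEquiv t s := by
        rw [Quotient.eq, lSetoid.comm']
        rfl
      rw [hq]
      refine and_congr_left fun h => ?_
      rw [← hw' t s h]
      simpa [LEquiv.nodes_eq h] using ht
    · rw [hw' t s (Finset.mem_filter.1 hs).2]
  rw [h]
  exact Submodule.smul_mem _ _ (Submodule.subset_span ⟨t, rfl⟩)

/-- Half products, as bilinear maps. -/
theorem sum_sum_smul_eq_linearCombination (f : List ℕ → List ℕ → FW ℚ) (x y : FW ℚ) :
    (x.sum fun u a => y.sum fun v b => (a * b) • f u v)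
      = Finsupp.linearCombination ℚ (fun u => Finsupp.linearCombination ℚ (f u)) x y := by
  simp only [Finsupp.linearCombination_apply, Finsupp.sum, LinearMap.sum_apply,
    LinearMap.smul_apply, Finset.smul_sum, mul_smul]

theorem preLieW_sum_sum {ι κ : Type*} (S : Finset ι) (T : Finset κ) (f : ι → FW ℚ)
    (g : κ → FW ℚ) :
    preLieW (∑ i ∈ S, f i) (∑ j ∈ T, g j) = ∑ i ∈ S, ∑ j ∈ T, preLieW (f i) (g j) := by
  simp only [preLieW, succExt, precExt, sum_sum_smul_eq_linearCombination, map_sum,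
    LinearMap.sum_apply, Finset.sum_sub_distrib]
  congr 1
  exact Finset.sum_comm

end LClass

theorem stmt17 : ∀ t1 t2 : BT,
    preLieW (LclassSum t1) (LclassSum t2)
      ∈ Submodule.span ℚ (Set.range LclassSum) := by
  classical
  intro t₁ t₂
  obtain ⟨w, hw⟩ : ∃ w : BT →₀ ℚ, w = ∑ x ∈ (allBT t₁.nodes).filter (fun x => LEquiv t₁ x),
      ∑ s ∈ (allBT t₂.nodes).filter (fun s => LEquiv t₂ s),
        (Finsupp.single (.nd x s) 1 + LClass.graft (fun u => Finsupp.single u (1 : ℚ)) x s) :=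
    ⟨_, rfl⟩
  have h₁ : preLieW (LclassSum t₁) (LclassSum t₂)
      = Finsupp.linearCombination ℚ (fun t => (cElt t : FW ℚ)) w := by
    rw [LclassSum, LclassSum, LClass.preLieW_sum_sum, hw]
    simp only [map_sum, map_add]
    refine Finset.sum_congr (by congr) fun x _ => Finset.sum_congr (by congr) fun s _ => ?_
    have h := LClass.map_graft (Finsupp.linearCombination ℚ
      (fun t => (cElt t : FW ℚ))).toAddMonoidHom (fun u => Finsupp.single u (1 : ℚ)) x s
    simp only [LinearMap.toAddMonoidHom_coe] at h
    rw [LClass.preLieW_cElt, h]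
    simp
  have h₂ (t : BT) : w t = LClass.cutIn (fun x s =>
      if LEquiv t₁ x ∧ LEquiv t₂ s then 1 else 0) t := by
    have h : (fun x s => if LEquiv t₁ x ∧ LEquiv t₂ s then (1 : ℚ) else 0) = fun y u =>
        ∑ x ∈ (allBT t₁.nodes).filter (fun x => LEquiv t₁ x),
          ∑ s ∈ (allBT t₂.nodes).filter (fun s => LEquiv t₂ s),
            if y = x ∧ u = s then (1 : ℚ) else 0 := by
      funext y u
      simp only [ite_and, Finset.sum_ite_eq, Finset.sum_ite_irrel, Finset.sum_const_zero,
        Finset.mem_filter, LClass.mem_allBT]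
      have hy : LEquiv t₁ y → y.nodes = t₁.nodes := fun h => (LClass.LEquiv.nodes_eq h).symm
      have hu : LEquiv t₂ u → u.nodes = t₂.nodes := fun h => (LClass.LEquiv.nodes_eq h).symm
      simp only [← ite_and, ← and_assoc, and_iff_right_of_imp hy]
      simp only [and_assoc, and_iff_right_of_imp hu]
    rw [h, LClass.cutIn_sum, hw, Finsupp.finsetSum_apply]
    refine Finset.sum_congr rfl fun x _ => ?_
    rw [LClass.cutIn_sum, Finsupp.finsetSum_apply]
    refine Finset.sum_congr rfl fun s _ => ?_
    have h := LClass.map_graft (Finsupp.applyAddHom t) (fun u => Finsupp.single u (1 : ℚ)) x s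
    simp only [Finsupp.applyAddHom_apply] at h
    rw [← (LClass.graft_indicator x s t).1, Finsupp.add_apply, h]
    simp only [Finsupp.single_apply]
  rw [h₁]
  refine LClass.linearCombination_cElt_mem_span fun t t' h => ?_
  rw [h₂, h₂]
  have hcongr {a b b' : BT} (h : LIn b b') : LEquiv a b ↔ LEquiv a b' :=
    ⟨fun k => k.trans _ _ _ (.rel _ _ h), fun k => k.trans _ _ _ (.symm _ _ (.rel _ _ h))⟩
  refine LClass.cutIn_eq_of_lIn h _ (fun x x' s k => ?_) (fun x s s' k => ?_)
  · simp only [hcongr k]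
  · simp only [hcongr k]
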